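/- (Weyl transform inversion) Every linear endomorphism A of ℂ(ZMod p) can be recovered from its matrix coefficients against the Heisenberg representation: A = p⁻¹ · Σ_{v ∈ (ZMod p)²} Tr(A ∘ π(−v, 0)) · π(v, 0), where the sum is over all v in (ZMod p)². -/

import Mathlib

open scoped BigOperators

noncomputable section

namespace DFTWeil

open scoped Classical

/-- Multiplication of the Heisenberg group `H = (V × V) × Z`,
`(v,z)·(v',z') = (v+v', z+z'+2⁻¹ ω(v,v'))` with `ω((t,w),(t',w')) = t w' - w t'`. -/
def hMul {p : ℕ} (a b : (ZMod p × ZMod p) × ZMod p) : (ZMod p × ZMod p) × ZMod p :=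
  (a.1 + b.1, a.2 + b.2 + (2 : ZMod p)⁻¹ * (a.1.1 * b.1.2 - a.1.2 * b.1.1))

/-- The additive character `ψ(z) = exp(2πi z/p)`. -/
def psi (p : ℕ) (z : ZMod p) : ℂ :=
  Complex.exp (2 * Real.pi * Complex.I * (z.val : ℂ) / p)

/-- The standard realization of the Heisenberg representation:
`(π((t,w),z) f)(x) = ψ(z + 2⁻¹ t w + w x) f(x+t)`. -/
def heis (p : ℕ) (h : (ZMod p × ZMod p) × ZMod p) :
    (ZMod p → ℂ) →ₗ[ℂ] (ZMod p → ℂ) where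
  toFun f x := psi p (h.2 + (2 : ZMod p)⁻¹ * h.1.1 * h.1.2 + h.1.2 * x) * f (x + h.1.1)
  map_add' f g := by funext x; simp [mul_add]
  map_smul' c f := by funext x; simp [Pi.smul_apply, smul_eq_mul]; ring

theorem psi_eq_stdAddChar (p : ℕ) [NeZero p] (z : ZMod p) : psi p z = ZMod.stdAddChar z := by
  rw [psi, ZMod.stdAddChar_apply, ZMod.toCircle_apply]

theorem sum_stdAddChar_mul (p : ℕ) [NeZero p] (b : ZMod p) :
    ∑ w : ZMod p, (ZMod.stdAddChar (w * b) : ℂ) = if b = 0 then (p : ℂ) else 0 := by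
  simpa using AddChar.sum_mulShift b (ZMod.isPrimitive_stdAddChar p)

theorem trace_eq_sum_apply_single {ι : Type*} [Fintype ι] [DecidableEq ι]
    (f : (ι → ℂ) →ₗ[ℂ] (ι → ℂ)) :
    LinearMap.trace ℂ (ι → ℂ) f = ∑ i, f (Pi.single i 1) i := by
  rw [LinearMap.trace_eq_matrix_trace ℂ (Pi.basisFun ℂ ι)]
  simp [Matrix.trace]

theorem heis_single (p : ℕ) [NeZero p] (t w z y : ZMod p) :
    heis p ((t, w), z) (Pi.single y 1) =
      (ZMod.stdAddChar (z + 2⁻¹ * t * w + w * (y - t)) : ℂ) • Pi.single (y - t) 1 := by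
  funext x
  by_cases h : x = y - t
  · subst h
    simp [heis, psi_eq_stdAddChar]
  · have h' : x + t ≠ y := fun e => h (eq_sub_of_add_eq e)
    simp [heis, h, h']

theorem trace_comp_heis (p : ℕ) [NeZero p] (A : (ZMod p → ℂ) →ₗ[ℂ] (ZMod p → ℂ))
    (t w z : ZMod p) :
    LinearMap.trace ℂ (ZMod p → ℂ) (A ∘ₗ heis p ((t, w), z)) =
      ∑ y, (ZMod.stdAddChar (z + 2⁻¹ * t * w + w * (y - t)) : ℂ) *
        A (Pi.single (y - t) 1) y := by
  simp [trace_eq_sum_apply_single, heis_single]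

/-- Weyl transform inversion: every endomorphism `A` of `ℂ(ZMod p)` equals
`p⁻¹ Σ_v Tr(A ∘ π(-v,0)) π(v,0)`. -/
theorem stmt5 (p : ℕ) [Fact p.Prime] (hp : p ≠ 2)
    (A : (ZMod p → ℂ) →ₗ[ℂ] (ZMod p → ℂ)) :
    A = (p : ℂ)⁻¹ • ∑ v : ZMod p × ZMod p,
      (LinearMap.trace ℂ (ZMod p → ℂ) (A ∘ₗ heis p (-v, 0))) • heis p (v, 0) := by
  have h2 : (2 : ZMod p) ≠ 0 := Ring.two_ne_zero (by rwa [ZMod.ringChar_zmod_n])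
  have hp0 : (p : ℂ) ≠ 0 := NeZero.ne _
  refine (Pi.basisFun ℂ (ZMod p)).ext fun j => ?_
  funext i
  simp only [Pi.basisFun_apply, LinearMap.smul_apply, LinearMap.sum_apply, Pi.smul_apply,
    Finset.sum_apply, smul_eq_mul, Fintype.sum_prod_type, Prod.neg_mk, trace_comp_heis,
    heis_single]
  rw [eq_inv_mul_iff_mul_eq₀ hp0, Finset.sum_eq_single (j - i)]
  · have key (w y : ZMod p) :
        (ZMod.stdAddChar (0 + 2⁻¹ * -(j - i) * -w + -w * (y - -(j - i))) : ℂ) *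
          ZMod.stdAddChar (0 + 2⁻¹ * (j - i) * w + w * (j - (j - i))) =
          ZMod.stdAddChar (w * (i - y)) := by
      rw [← AddChar.map_add_eq_mul]
      congr 1
      field_simp
      ring
    have term (w y : ZMod p) (a : ℂ) :
        (ZMod.stdAddChar (0 + 2⁻¹ * -(j - i) * -w + -w * (y - -(j - i))) : ℂ) * a *
          (ZMod.stdAddChar (0 + 2⁻¹ * (j - i) * w + w * (j - (j - i))) *
            (Pi.single (j - (j - i)) 1 : ZMod p → ℂ) i) =
          ZMod.stdAddChar (w * (i - y)) * a := by
      rw [← key, sub_sub_cancel, Pi.single_eq_same]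
      ring
    simp only [Finset.sum_mul, term]
    rw [Finset.sum_comm]
    simp only [← Finset.sum_mul, sum_stdAddChar_mul, sub_eq_zero, ite_mul, zero_mul,
      Finset.sum_ite_eq, Finset.mem_univ, if_true]
    simp
  · intro t _ ht
    have h : i ≠ j - t := fun e => ht (by rw [e]; ring)
    simp [h]
  · simp

end DFTWeil
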